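/- arXiv:2010.10650 — 3 statements merged into one kernel-verified Lean document; each statement's English description precedes it below -/
import Mathlib

section
/- Let ε > 0 and let δ, δ₀ ∈ E satisfy ‖δ‖ = ‖δ₀‖ = ε and ‖δ − δ₀‖ < ε. Then the normal component of δ − δ₀ at δ₀ is controlled by the square of its tangential component: ‖(⟨δ − δ₀, δ₀⟩/ε²)·δ₀‖ ≤ ‖(δ − δ₀) − (⟨δ − δ₀, δ₀⟩/ε²)·δ₀‖² / ε. -/
open RealInnerProductSpace

/-- For two nearby points `δ, δ₀` on the sphere of radius `ε`, the normal component of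
`δ - δ₀` at `δ₀` is controlled by the square of its tangential component. -/
theorem normal_component_le_sq_tangential {E : Type*} [NormedAddCommGroup E]
    [InnerProductSpace ℝ E]
    (ε : ℝ) (hε : 0 < ε) (δ δ₀ : E) (hδ : ‖δ‖ = ε) (hδ₀ : ‖δ₀‖ = ε)
    (hclose : ‖δ - δ₀‖ < ε) :
    ‖(⟪δ - δ₀, δ₀⟫ / ε ^ 2) • δ₀‖ ≤
      ‖(δ - δ₀) - (⟪δ - δ₀, δ₀⟫ / ε ^ 2) • δ₀‖ ^ 2 / ε := by
  have h_inner : ⟪δ - δ₀, δ₀⟫ = -‖δ - δ₀‖ ^ 2 / 2 := by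
    have h := norm_sub_sq_real δ δ₀
    rw [inner_sub_left, real_inner_self_eq_norm_sq]
    rw [hδ, hδ₀] at h
    rw [hδ₀]
    linarith
  obtain ⟨c, hc⟩ : ∃ c, c = ⟪δ - δ₀, δ₀⟫ / ε ^ 2 := ⟨_, rfl⟩
  have hcε : ⟪δ - δ₀, δ₀⟫ = c * ε ^ 2 := by
    rw [hc]
    field_simp
  have h_sq : ‖δ - δ₀‖ ^ 2 = -2 * c * ε ^ 2 := by linarith
  have hε2 : 0 < ε ^ 2 := by positivity
  have hc_nonpos : c ≤ 0 := by nlinarith [sq_nonneg ‖δ - δ₀‖]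
  have hc_ge : -1 ≤ c := by nlinarith [norm_nonneg (δ - δ₀)]
  have h_tangential : ‖(δ - δ₀) - c • δ₀‖ ^ 2 = (-2 * c - c ^ 2) * ε ^ 2 := by
    rw [norm_sub_sq_real, real_inner_smul_right, norm_smul, mul_pow, Real.norm_eq_abs, sq_abs,
      hδ₀, hcε, h_sq]
    ring
  rw [← hc, h_tangential, norm_smul, hδ₀, Real.norm_eq_abs, abs_of_nonpos hc_nonpos,
    le_div_iff₀ hε]
  nlinarith [mul_nonneg (mul_nonneg (neg_nonneg.2 hc_nonpos) (neg_le_iff_add_nonneg.1 hc_ge))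
    hε2.le]
end

section
/- Let ε > 0, η > 0, let δ₀ ∈ E satisfy ‖δ₀‖ = ε, and let v̂ ∈ E be a unit vector. Suppose the stepped point δ̃₁ = δ₀ + η·v̂ satisfies ‖δ̃₁‖ ≥ ε, so that its metric projection onto the closed ball B(0, ε) is z₁ = (ε/‖δ̃₁‖)·δ̃₁. Let δ̃₂ = δ₀ + η·(v̂ − (⟨v̂, δ₀⟩/ε²)·δ₀) be the point obtained by stepping along the projection of v̂ onto the tangent space at δ₀. Then ‖z₁ − δ̃₂‖ ≤ 4η²/ε. -/
open RealInnerProductSpace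

/-- Approximation of a projected gradient step by a tangential step: starting from
`δ₀` on the sphere of radius `ε`, stepping by `η` along a unit vector `v̂` and
projecting back onto the ball is within `4η²/ε` of stepping along the projection of
`v̂` onto the tangent space at `δ₀`. -/
theorem pgd_step_approx {E : Type*} [NormedAddCommGroup E] [InnerProductSpace ℝ E]
    (ε η : ℝ) (hε : 0 < ε) (hη : 0 < η) (δ₀ v : E)
    (hδ₀ : ‖δ₀‖ = ε) (hv : ‖v‖ = 1)
    (hout : ε ≤ ‖δ₀ + η • v‖) :
    ‖(ε / ‖δ₀ + η • v‖) • (δ₀ + η • v) -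
      (δ₀ + η • (v - (⟪v, δ₀⟫ / ε ^ 2) • δ₀))‖ ≤ 4 * η ^ 2 / ε := by
  have hnorm : ‖δ₀ + η • v‖ ^ 2 = ε ^ 2 + 2 * (η * ⟪v, δ₀⟫) + η ^ 2 := by
    rw [norm_add_sq_real, inner_smul_right, norm_smul, hδ₀, hv, real_inner_comm,
      Real.norm_of_nonneg hη.le, mul_one]
  have hstep : ‖δ₀ + η • v‖ ≤ ε + η := by
    simpa [norm_smul, hδ₀, hv, abs_of_pos hη] using norm_add_le δ₀ (η • v)
  have hsplit : (ε / ‖δ₀ + η • v‖) • (δ₀ + η • v) -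
      (δ₀ + η • (v - (⟪v, δ₀⟫ / ε ^ 2) • δ₀)) =
      (ε / ‖δ₀ + η • v‖ - 1 + η * ⟪v, δ₀⟫ / ε ^ 2) • δ₀ +
        (η * (ε / ‖δ₀ + η • v‖ - 1)) • v := by
    module
  rw [hsplit]
  generalize ‖δ₀ + η • v‖ = N at *
  obtain ⟨d, rfl⟩ : ∃ d, N = ε + d := ⟨N - ε, by ring⟩
  have hd : 0 ≤ d := by linarith
  have hdη : d ≤ η := by linarith
  have hN : 0 < ε + d := by linarith
  have hsq : d ^ 2 ≤ η ^ 2 := by gcongr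
  have hs : η * ⟪v, δ₀⟫ = ε * d + (d ^ 2 - η ^ 2) / 2 := by linarith
  have hradial : ε / (ε + d) - 1 + η * ⟪v, δ₀⟫ / ε ^ 2 =
      d ^ 2 / ((ε + d) * ε) - (η ^ 2 - d ^ 2) / (2 * ε ^ 2) := by
    rw [hs]
    field_simp
    ring
  have hpos : d ^ 2 / ((ε + d) * ε) ≤ η ^ 2 / ε ^ 2 := by
    rw [sq ε]
    gcongr
  have hneg : (η ^ 2 - d ^ 2) / (2 * ε ^ 2) ≤ η ^ 2 / ε ^ 2 := by
    gcongr <;> nlinarith [sq_nonneg d, sq_nonneg ε]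
  have hpos₀ : 0 ≤ d ^ 2 / ((ε + d) * ε) := by positivity
  have hneg₀ : 0 ≤ (η ^ 2 - d ^ 2) / (2 * ε ^ 2) :=
    div_nonneg (by linarith) (by positivity)
  have hcoeff : |ε / (ε + d) - 1 + η * ⟪v, δ₀⟫ / ε ^ 2| ≤ η ^ 2 / ε ^ 2 := by
    rw [hradial, abs_le]
    constructor <;> linarith
  have hscale : |ε / (ε + d) - 1| ≤ η / ε := by
    have h : ε / (ε + d) - 1 = -(d / (ε + d)) := by
      field_simp
      ring
    rw [h, abs_neg, abs_of_nonneg (by positivity)]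
    gcongr
  calc
    _ ≤ |ε / (ε + d) - 1 + η * ⟪v, δ₀⟫ / ε ^ 2| * ε + η * |ε / (ε + d) - 1| := by
      refine (norm_add_le _ _).trans_eq ?_
      rw [norm_smul, norm_smul, hδ₀, hv, Real.norm_eq_abs, Real.norm_eq_abs, abs_mul,
        abs_of_pos hη, mul_one]
    _ ≤ η ^ 2 / ε ^ 2 * ε + η * (η / ε) := by gcongr
    _ = 2 * η ^ 2 / ε := by
      field_simp
      ring
    _ ≤ 4 * η ^ 2 / ε := by
      gcongr
      norm_num
end

section
/- Let L : E → ℝ, let δ, δ' ∈ E, let g ∈ E, and let η, ε, ν, ρ > 0. Suppose the Taylor-type upper bound L(δ') ≤ L(δ) + ⟨g, δ' − δ⟩ + (ν/2)·‖δ' − δ‖² + (ρ/6)·‖δ' − δ‖³ holds, and that δ' approximates the gradient step in the sense that ‖δ' − (δ − η·g)‖ ≤ 4η²/ε. Then L(δ') − L(δ) ≤ −η·‖g‖² + (4η²/ε)·‖g‖ + (ν/2)·(η‖g‖ + 4η²/ε)² + (ρ/6)·(η‖g‖ + 4η²/ε)³. -/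
open RealInnerProductSpace

/-- Per-step progress estimate on the sphere: combining a Taylor-type upper bound with
the `4η²/ε` approximation of the projected gradient step by a tangential step. -/
theorem per_step_progress {E : Type*} [NormedAddCommGroup E] [InnerProductSpace ℝ E]
    (L : E → ℝ) (δ δ' g : E) (η ε ν ρ : ℝ)
    (hη : 0 < η) (hε : 0 < ε) (hν : 0 < ν) (hρ : 0 < ρ)
    (htaylor : L δ' ≤ L δ + ⟪g, δ' - δ⟫ + (ν / 2) * ‖δ' - δ‖ ^ 2
      + (ρ / 6) * ‖δ' - δ‖ ^ 3)
    (hstep : ‖δ' - (δ - η • g)‖ ≤ 4 * η ^ 2 / ε) :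
    L δ' - L δ ≤ -η * ‖g‖ ^ 2 + (4 * η ^ 2 / ε) * ‖g‖
      + (ν / 2) * (η * ‖g‖ + 4 * η ^ 2 / ε) ^ 2
      + (ρ / 6) * (η * ‖g‖ + 4 * η ^ 2 / ε) ^ 3 := by
  have hsplit : δ' - δ = (δ' - (δ - η • g)) - η • g := by abel
  have hnorm : ‖δ' - δ‖ ≤ η * ‖g‖ + 4 * η ^ 2 / ε := by
    rw [hsplit]
    have h := norm_sub_le (δ' - (δ - η • g)) (η • g)
    rw [norm_smul, Real.norm_of_nonneg hη.le] at h
    linarith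
  have hinner : ⟪g, δ' - δ⟫ ≤ -η * ‖g‖ ^ 2 + (4 * η ^ 2 / ε) * ‖g‖ := by
    rw [hsplit, inner_sub_right, real_inner_smul_right, real_inner_self_eq_norm_sq]
    have h := real_inner_le_norm g (δ' - (δ - η • g))
    have h' := mul_le_mul_of_nonneg_left hstep (norm_nonneg g)
    linarith
  have hquad : (ν / 2) * ‖δ' - δ‖ ^ 2 ≤ (ν / 2) * (η * ‖g‖ + 4 * η ^ 2 / ε) ^ 2 := by
    gcongr
  have hcubic : (ρ / 6) * ‖δ' - δ‖ ^ 3 ≤ (ρ / 6) * (η * ‖g‖ + 4 * η ^ 2 / ε) ^ 3 := by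
    gcongr
  linarith
end
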